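/- arXiv:2507.07782 — 3 statements merged into one kernel-verified Lean document; each statement's English description precedes it below -/
import Mathlib

section
/- Let (X,d) be a compact metric space, f : X → X continuous, and φ, ψ ∈ C(X,ℝ) with ψ > 0, and let T > 0. If α is an open cover of X with Lebesgue number δ, then q_{ψ,T}(f,φ,α) ≤ Q_{ψ,T}(f,φ,δ/2) ≤ P_{ψ,T}(f,φ,δ/2). -/
open Filter Set Topology MeasureTheory ENNReal

variable {X : Type*}

/-- Birkhoff sum `S_n φ = ∑_{i<n} φ ∘ f^i`. -/
def birkhoff (f : X → X) (φ : X → ℝ) (n : ℕ) (x : X) : ℝ :=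
  ∑ i ∈ Finset.range n, φ (f^[i] x)

section Metric
variable [MetricSpace X]

/-- `F` is an `(n,ε)`-spanning set of `Z`: every `y ∈ Z` is within Bowen distance
`d_n ≤ ε` of some point of `F`. -/
def IsSpanningSetOf (f : X → X) (n : ℕ) (ε : ℝ) (Z : Set X) (F : Finset X) : Prop :=
  ∀ y ∈ Z, ∃ x ∈ F, ∀ i < n, dist (f^[i] x) (f^[i] y) ≤ ε

/-- `E` is an `(n,ε)`-separated set of `Z`: `E ⊆ Z` and distinct points of `E` are at
Bowen distance `d_n > ε`. -/
def IsSeparatedSetOf (f : X → X) (n : ℕ) (ε : ℝ) (Z : Set X) (E : Finset X) : Prop :=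
  (E : Set X) ⊆ Z ∧ ∀ x ∈ E, ∀ y ∈ E, x ≠ y → ∃ i < n, ε < dist (f^[i] x) (f^[i] y)

/-- `S_T = {n : ℕ | ∃ x, S_nψ(x) ≤ T < S_{n+1}ψ(x)}`. -/
def inducedST (f : X → X) (ψ : X → ℝ) (T : ℝ) : Set ℕ :=
  {n | ∃ x : X, birkhoff f ψ n x ≤ T ∧ T < birkhoff f ψ (n + 1) x}

/-- `X_n = {x | S_nψ(x) ≤ T < S_{n+1}ψ(x)}`. -/
def inducedXn (f : X → X) (ψ : X → ℝ) (T : ℝ) (n : ℕ) : Set X :=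
  {x | birkhoff f ψ n x ≤ T ∧ T < birkhoff f ψ (n + 1) x}

/-- `Q_{ψ,T}(f,φ,ε)`: infimum over families of `(n,ε)`-spanning sets of the `X_n`, `n ∈ S_T`,
of `∑_{n ∈ S_T} ∑_{x ∈ F_n} e^{S_nφ(x)}`. -/
noncomputable def inducedQ (f : X → X) (ψ φ : X → ℝ) (T ε : ℝ) : ℝ≥0∞ :=
  ⨅ (F : ℕ → Finset X) (_ : ∀ n ∈ inducedST f ψ T,
      IsSpanningSetOf f n ε (inducedXn f ψ T n) (F n)),
    ∑' n : inducedST f ψ T, ∑ x ∈ F n, ENNReal.ofReal (Real.exp (birkhoff f φ n x))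

/-- `P_{ψ,T}(f,φ,ε)`: supremum over families of `(n,ε)`-separated sets of the `X_n`, `n ∈ S_T`,
of `∑_{n ∈ S_T} ∑_{x ∈ E_n} e^{S_nφ(x)}`. -/
noncomputable def inducedPsep (f : X → X) (ψ φ : X → ℝ) (T ε : ℝ) : ℝ≥0∞ :=
  ⨆ (E : ℕ → Finset X) (_ : ∀ n ∈ inducedST f ψ T,
      IsSeparatedSetOf f n ε (inducedXn f ψ T n) (E n)),
    ∑' n : inducedST f ψ T, ∑ x ∈ E n, ENNReal.ofReal (Real.exp (birkhoff f φ n x))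

/-- The ψ-induced topological pressure
`P_ψ(φ) = lim_{ε→0⁺} limsup_{T→∞} (1/T) log Q_{ψ,T}(f,φ,ε)`, the limit as `ε → 0⁺`
being realized as a `limsup` along `𝓝[>] 0` (since `ε ↦ limsup_T …` is monotone,
this coincides with the limit). -/
noncomputable def inducedPressure (f : X → X) (ψ φ : X → ℝ) : EReal :=
  limsup (fun ε : ℝ =>
    limsup (fun T : ℝ => ENNReal.log (inducedQ f ψ φ T ε) * ((T⁻¹ : ℝ) : EReal)) atTop)
    (𝓝[>] (0 : ℝ))

/-- Topological entropy `h_top(f) = P_ψ(0)` with `ψ ≡ 1`. -/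
noncomputable def topEntropy (f : X → X) : EReal :=
  inducedPressure f (fun _ => 1) (fun _ => 0)

end Metric
section Cover
variable [MetricSpace X]

/-- `α` is an open cover of `X`. -/
def IsOpenCover (α : Set (Set X)) : Prop :=
  (∀ A ∈ α, IsOpen A) ∧ ⋃₀ α = univ

/-- The dynamical refinement `⋁_{i=0}^{n-1} f^{-i} α`: sets of the form
`A_0 ∩ f^{-1}A_1 ∩ ⋯ ∩ f^{-(n-1)}A_{n-1}` with `A_i ∈ α`. -/
def dynRefine (f : X → X) (α : Set (Set X)) (n : ℕ) : Set (Set X) :=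
  {B | ∃ A : ℕ → Set X, (∀ i < n, A i ∈ α) ∧ B = ⋂ i ∈ Finset.range n, f^[i] ⁻¹' A i}

/-- `q_{ψ,T}(f,φ,α)`: infimum over finite subfamilies `β_n ⊆ ⋁_{i<n} f^{-i}α` covering `X_n`
(`n ∈ S_T`) of `∑_{n ∈ S_T} ∑_{B ∈ β_n} inf_{x ∈ B} e^{S_nφ(x)}`. -/
noncomputable def inducedq (f : X → X) (ψ φ : X → ℝ) (T : ℝ) (α : Set (Set X)) : ℝ≥0∞ :=
  ⨅ (β : ℕ → Finset (Set X)) (_ : ∀ n ∈ inducedST f ψ T,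
      ((β n : Set (Set X)) ⊆ dynRefine f α n ∧ inducedXn f ψ T n ⊆ ⋃₀ (β n : Set (Set X)))),
    ∑' n : inducedST f ψ T, ∑ B ∈ β n, ⨅ x ∈ B, ENNReal.ofReal (Real.exp (birkhoff f φ n x))

/-- `p_{ψ,T}(f,φ,α)`: infimum over finite subfamilies `β_n ⊆ ⋁_{i<n} f^{-i}α` covering `X_n`
(`n ∈ S_T`) of `∑_{n ∈ S_T} ∑_{B ∈ β_n} sup_{x ∈ B} e^{S_nφ(x)}`. -/
noncomputable def inducedp (f : X → X) (ψ φ : X → ℝ) (T : ℝ) (α : Set (Set X)) : ℝ≥0∞ :=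
  ⨅ (β : ℕ → Finset (Set X)) (_ : ∀ n ∈ inducedST f ψ T,
      ((β n : Set (Set X)) ⊆ dynRefine f α n ∧ inducedXn f ψ T n ⊆ ⋃₀ (β n : Set (Set X)))),
    ∑' n : inducedST f ψ T, ∑ B ∈ β n, ⨆ x ∈ B, ENNReal.ofReal (Real.exp (birkhoff f φ n x))

end Cover

section InducedPressureInequalities
variable [MetricSpace X]

lemma exists_card_le_of_isSeparatedSetOf [CompactSpace X] {f : X → X} (hf : Continuous f)
    (n : ℕ) {ε : ℝ} (hε : 0 < ε) (Z : Set X) :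
    ∃ N : ℕ, ∀ E : Finset X, IsSeparatedSetOf f n ε Z E → E.card ≤ N := by
  let U : X → Set X := fun x => ⋂ i ∈ Finset.range n, {y | dist (f^[i] x) (f^[i] y) < ε / 2}
  have hUo (x : X) : IsOpen (U x) :=
    isOpen_biInter_finset fun i _ =>
      isOpen_lt (continuous_const.dist (hf.iterate i)) continuous_const
  have hUx (x : X) : x ∈ U x := by simp [U, hε]
  obtain ⟨t, ht⟩ := isCompact_univ.elim_finite_subcover U hUo
    fun x _ => mem_iUnion.2 ⟨x, hUx x⟩
  have hcover (y : X) : ∃ x ∈ t, y ∈ U x := by simpa using ht (mem_univ y)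
  choose c hct hc using hcover
  refine ⟨t.card, fun E hE => Finset.card_le_card_of_injOn c (fun y _ => hct y) ?_⟩
  intro x hx y hy hxy
  by_contra hne
  obtain ⟨i, hi, hlt⟩ := hE.2 x hx y hy hne
  have h1 : dist (f^[i] (c x)) (f^[i] x) < ε / 2 :=
    mem_iInter₂.1 (hc x) i (Finset.mem_range.2 hi)
  have h2 : dist (f^[i] (c x)) (f^[i] y) < ε / 2 := by
    rw [hxy]
    exact mem_iInter₂.1 (hc y) i (Finset.mem_range.2 hi)
  linarith [dist_triangle_left (f^[i] x) (f^[i] y) (f^[i] (c x))]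

lemma exists_isSeparatedSetOf_isSpanningSetOf [CompactSpace X] {f : X → X} (hf : Continuous f)
    (n : ℕ) {ε : ℝ} (hε : 0 < ε) (Z : Set X) :
    ∃ E : Finset X, IsSeparatedSetOf f n ε Z E ∧ IsSpanningSetOf f n ε Z E := by
  classical
  obtain ⟨N, hN⟩ := exists_card_le_of_isSeparatedSetOf hf n hε Z
  let P : ℕ → Prop := fun k => ∃ E : Finset X, IsSeparatedSetOf f n ε Z E ∧ E.card = k
  have hP : P 0 := ⟨∅, by simp [IsSeparatedSetOf], rfl⟩
  obtain ⟨E, hE, hcard⟩ := Nat.findGreatest_spec (Nat.zero_le N) hP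
  refine ⟨E, hE, fun y hy => ?_⟩
  by_contra! hfar
  have hyE : y ∉ E := fun h => by
    obtain ⟨i, -, hi⟩ := hfar y h
    rw [dist_self] at hi
    exact hi.not_gt hε
  have hsep : IsSeparatedSetOf f n ε Z (insert y E) := by
    refine ⟨by simpa [insert_subset_iff] using ⟨hy, hE.1⟩, fun a ha b hb hab => ?_⟩
    rcases Finset.mem_insert.1 ha with rfl | haE <;>
      rcases Finset.mem_insert.1 hb with rfl | hbE
    · exact absurd rfl hab
    · simpa only [dist_comm] using hfar b hbE
    · exact hfar a haE
    · exact hE.2 a haE b hbE hab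
  have hle := Nat.le_findGreatest (P := P) (hN _ hsep) ⟨_, hsep, rfl⟩
  rw [Finset.card_insert_of_notMem hyE] at hle
  omega

lemma inducedQ_le_inducedPsep [CompactSpace X] {f : X → X} (hf : Continuous f)
    (ψ φ : X → ℝ) (T : ℝ) {ε : ℝ} (hε : 0 < ε) :
    inducedQ f ψ φ T ε ≤ inducedPsep f ψ φ T ε := by
  choose E hsep hspan using fun n =>
    exists_isSeparatedSetOf_isSpanningSetOf hf n hε (inducedXn f ψ T n)
  exact (iInf₂_le E fun n _ => hspan n).trans
    (le_iSup₂_of_le E (fun n _ => hsep n) le_rfl)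

lemma inducedq_le_inducedQ (f : X → X) (ψ φ : X → ℝ) (T : ℝ) {α : Set (Set X)} {ε δ : ℝ}
    (hδ : 0 < δ) (hεδ : ε < δ)
    (hLeb : ∀ x : X, ∃ A ∈ α, Metric.ball x δ ⊆ A) :
    inducedq f ψ φ T α ≤ inducedQ f ψ φ T ε := by
  classical
  choose A hAα hA using hLeb
  refine le_iInf₂ fun F hF => ?_
  let B : ℕ → X → Set X := fun n x => ⋂ i ∈ Finset.range n, f^[i] ⁻¹' A (f^[i] x)
  have hmem {n : ℕ} {x y : X} (h : ∀ i < n, dist (f^[i] x) (f^[i] y) < δ) : y ∈ B n x :=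
    mem_iInter₂.2 fun i hi => hA _ <| by
      simpa [dist_comm] using h i (Finset.mem_range.1 hi)
  refine iInf₂_le_of_le (fun n => (F n).image (B n))
    (fun n hn => ⟨fun C hC => ?_, fun y hy => ?_⟩) (ENNReal.tsum_le_tsum fun n => ?_)
  · obtain ⟨x, -, rfl⟩ := Finset.mem_image.1 (Finset.mem_coe.1 hC)
    exact ⟨fun i => A (f^[i] x), fun i _ => hAα _, rfl⟩
  · obtain ⟨x, hx, hxy⟩ := hF n hn y hy
    exact ⟨B n x, Finset.mem_coe.2 (Finset.mem_image_of_mem _ hx),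
      hmem fun i hi => (hxy i hi).trans_lt hεδ⟩
  · refine (Finset.sum_image_le_of_nonneg fun _ _ => zero_le).trans
      (Finset.sum_le_sum fun x _ => ?_)
    exact iInf₂_le x (hmem fun i _ => by simpa using hδ)

end InducedPressureInequalities

/-- If `α` is an open cover of the compact metric space `X` with Lebesgue
number `δ`, then `q_{ψ,T}(f,φ,α) ≤ Q_{ψ,T}(f,φ,δ/2) ≤ P_{ψ,T}(f,φ,δ/2)`. -/
theorem induced_q_le_Q_le_Psep
    {X : Type*} [MetricSpace X] [CompactSpace X]
    (f : X → X) (hf : Continuous f)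
    (φ ψ : X → ℝ) (hφ : Continuous φ) (hψ : Continuous ψ) (hψpos : ∀ x, 0 < ψ x)
    (T : ℝ) (hT : 0 < T)
    (α : Set (Set X)) (hα : IsOpenCover α)
    (δ : ℝ) (hδ : 0 < δ) (hLeb : ∀ x : X, ∃ A ∈ α, Metric.ball x δ ⊆ A) :
    inducedq f ψ φ T α ≤ inducedQ f ψ φ T (δ / 2) ∧
      inducedQ f ψ φ T (δ / 2) ≤ inducedPsep f ψ φ T (δ / 2) := by
  exact ⟨inducedq_le_inducedQ f ψ φ T hδ (half_lt_self hδ) hLeb,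
    inducedQ_le_inducedPsep hf ψ φ T (half_pos hδ)⟩
end

section
/- Let (X,d) be a compact metric space, f : X → X continuous, and ψ ∈ C(X,ℝ) with ψ > 0. If P_ψ(φ) < ∞ for every φ ∈ C(X,ℝ), then the ψ-induced topological pressure functional is convex: for all φ₁, φ₂ ∈ C(X,ℝ) and all t ∈ [0,1], P_ψ(tφ₁ + (1−t)φ₂) ≤ t P_ψ(φ₁) + (1−t) P_ψ(φ₂). -/
open Filter Set Topology MeasureTheory ENNReal

variable {X : Type*}

theorem IsSpanningSetOf.exists_injOn {X : Type*} [MetricSpace X] {f : X → X} {n : ℕ} {ε : ℝ}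
    {Z : Set X} {F E : Finset X} (hF : IsSpanningSetOf f n (ε / 2) Z F)
    (hE : IsSeparatedSetOf f n ε Z E) :
    ∃ g : X → X, (∀ x ∈ E, g x ∈ F ∧ ∀ i < n, dist (f^[i] (g x)) (f^[i] x) ≤ ε / 2) ∧
      Set.InjOn g E := by
  choose! g hg using hF
  refine ⟨g, fun x hx => hg x (hE.1 hx), fun x hx y hy hxy => ?_⟩
  by_contra hne
  obtain ⟨i, hi, hlt⟩ := hE.2 x hx y hy hne
  have h₁ := (hg x (hE.1 hx)).2 i hi
  have h₂ := (hg y (hE.1 hy)).2 i hi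
  rw [← hxy] at h₂
  linarith [dist_triangle_left (f^[i] x) (f^[i] y) (f^[i] (g x))]

/-- A separated set of maximal cardinality is spanning. -/
theorem IsSpanningSetOf.exists_separated {X : Type*} [MetricSpace X] {f : X → X} {n : ℕ} {ε : ℝ}
    {Z : Set X} {F : Finset X} (hε : 0 < ε) (hF : IsSpanningSetOf f n (ε / 2) Z F) :
    ∃ E : Finset X, IsSeparatedSetOf f n ε Z E ∧ IsSpanningSetOf f n ε Z E := by
  classical
  let s : Set ℕ := {k | ∃ E : Finset X, IsSeparatedSetOf f n ε Z E ∧ E.card = k}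
  have hne : s.Nonempty := ⟨0, ∅, ⟨by simp, by simp⟩, rfl⟩
  have hbdd : BddAbove s := by
    refine ⟨F.card, ?_⟩
    rintro _ ⟨E, hE, rfl⟩
    obtain ⟨g, hg, hinj⟩ := hF.exists_injOn hE
    exact Finset.card_le_card_of_injOn g (fun x hx => (hg x hx).1) hinj
  obtain ⟨E, hE, hcard⟩ := Nat.sSup_mem hne hbdd
  refine ⟨E, hE, fun y hy => ?_⟩
  by_contra! hfar
  have hyE : y ∉ E := fun h => by
    obtain ⟨i, _, hi⟩ := hfar y h
    rw [dist_self] at hi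
    linarith
  have hmem : (insert y E).card ∈ s := by
    refine ⟨insert y E, ⟨?_, ?_⟩, rfl⟩
    · rw [Finset.coe_insert]
      exact Set.insert_subset hy hE.1
    · intro a ha b hb hab
      rcases Finset.mem_insert.1 ha with rfl | haE <;>
        rcases Finset.mem_insert.1 hb with rfl | hbE
      · exact absurd rfl hab
      · simpa only [dist_comm] using hfar b hbE
      · exact hfar a haE
      · exact hE.2 a haE b hbE hab
  have := le_csSup hbdd hmem
  rw [Finset.card_insert_of_notMem hyE] at this
  omega

theorem birkhoff_le_birkhoff_add {X : Type*} {f : X → X} {φ : X → ℝ} {n : ℕ} {δ : ℝ} {x y : X}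
    (h : ∀ i < n, φ (f^[i] x) ≤ φ (f^[i] y) + δ) :
    birkhoff f φ n x ≤ birkhoff f φ n y + n * δ := by
  have := Finset.sum_le_sum fun i hi => h i (Finset.mem_range.1 hi)
  simpa [birkhoff, Finset.sum_add_distrib] using this

theorem mul_le_of_mem_inducedST {X : Type*} [MetricSpace X] {f : X → X} {ψ : X → ℝ} {T c : ℝ}
    {n : ℕ} (hc : ∀ x, c ≤ ψ x) (hn : n ∈ inducedST f ψ T) : n * c ≤ T := by
  obtain ⟨x, hx, -⟩ := hn
  refine le_trans ?_ hx
  simpa [birkhoff] using Finset.sum_le_sum (s := Finset.range n) fun i _ => hc (f^[i] x)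

theorem tsum_separated_le {X : Type*} [MetricSpace X] {f : X → X} {ψ φ : X → ℝ} {T ε c η : ℝ}
    {E F : ℕ → Finset X} (hc : ∀ x, c ≤ ψ x) (hη : 0 ≤ η)
    (hφ : ∀ x y, dist x y ≤ ε / 2 → dist (φ x) (φ y) ≤ η * c)
    (hE : ∀ n ∈ inducedST f ψ T, IsSeparatedSetOf f n ε (inducedXn f ψ T n) (E n))
    (hF : ∀ n ∈ inducedST f ψ T, IsSpanningSetOf f n (ε / 2) (inducedXn f ψ T n) (F n)) :
    ∑' n : inducedST f ψ T, ∑ x ∈ E n, ENNReal.ofReal (Real.exp (birkhoff f φ n x)) ≤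
      ENNReal.ofReal (Real.exp (η * T)) *
        ∑' n : inducedST f ψ T, ∑ x ∈ F n, ENNReal.ofReal (Real.exp (birkhoff f φ n x)) := by
  classical
  rw [← ENNReal.tsum_mul_left]
  refine ENNReal.tsum_le_tsum fun n => ?_
  obtain ⟨g, hg, hinj⟩ := (hF n n.2).exists_injOn (hE n n.2)
  have hnT := mul_le_of_mem_inducedST hc n.2
  calc ∑ x ∈ E n, ENNReal.ofReal (Real.exp (birkhoff f φ n x))
      ≤ ∑ x ∈ E n, ENNReal.ofReal (Real.exp (η * T)) *
          ENNReal.ofReal (Real.exp (birkhoff f φ n (g x))) := by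
        refine Finset.sum_le_sum fun x hx => ?_
        rw [← ENNReal.ofReal_mul (Real.exp_nonneg _), ← Real.exp_add]
        refine ENNReal.ofReal_le_ofReal (Real.exp_le_exp.2 ?_)
        have := birkhoff_le_birkhoff_add (f := f) (φ := φ) (n := n) (x := x) (y := g x)
          (δ := η * c) fun i hi => by
            have := (abs_le.1 (hφ _ _ ((hg x hx).2 i hi))).1
            linarith
        nlinarith
    _ = ∑ y ∈ (E n).image g, ENNReal.ofReal (Real.exp (η * T)) *
          ENNReal.ofReal (Real.exp (birkhoff f φ n y)) := by rw [Finset.sum_image hinj]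
    _ ≤ ∑ y ∈ F n, ENNReal.ofReal (Real.exp (η * T)) *
          ENNReal.ofReal (Real.exp (birkhoff f φ n y)) :=
        Finset.sum_le_sum_of_subset
          (Finset.image_subset_iff.2 fun x hx => (hg x hx).1)
    _ = _ := (Finset.mul_sum ..).symm

theorem tsum_exp_convexCombination_le {X : Type*} {f : X → X} {φ₁ φ₂ : X → ℝ} {t A B : ℝ}
    (ht : t ∈ Set.Icc (0 : ℝ) 1) (s : Set ℕ) (E : ℕ → Finset X)
    (h₁ : ∑' n : s, ∑ x ∈ E n, ENNReal.ofReal (Real.exp (birkhoff f φ₁ n x)) ≤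
      ENNReal.ofReal (Real.exp A))
    (h₂ : ∑' n : s, ∑ x ∈ E n, ENNReal.ofReal (Real.exp (birkhoff f φ₂ n x)) ≤
      ENNReal.ofReal (Real.exp B)) :
    ∑' n : s, ∑ x ∈ E n, ENNReal.ofReal
        (Real.exp (birkhoff f (fun x => t * φ₁ x + (1 - t) * φ₂ x) n x)) ≤
      ENNReal.ofReal (Real.exp (t * A + (1 - t) * B)) := by
  have ht₀ := ht.1
  have ht₁ : 0 ≤ 1 - t := sub_nonneg.2 ht.2
  set K := t * A + (1 - t) * B with hK
  set u := t * Real.exp (K - A) with hu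
  set v := (1 - t) * Real.exp (K - B) with hv
  have hu₀ : 0 ≤ u := by positivity
  have hv₀ : 0 ≤ v := by positivity
  have key (n : ℕ) (x : X) :
      ENNReal.ofReal (Real.exp (birkhoff f (fun x => t * φ₁ x + (1 - t) * φ₂ x) n x)) ≤
        ENNReal.ofReal u * ENNReal.ofReal (Real.exp (birkhoff f φ₁ n x)) +
          ENNReal.ofReal v * ENNReal.ofReal (Real.exp (birkhoff f φ₂ n x)) := by
    rw [← ENNReal.ofReal_mul hu₀, ← ENNReal.ofReal_mul hv₀,
      ← ENNReal.ofReal_add (by positivity) (by positivity)]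
    refine ENNReal.ofReal_le_ofReal ?_
    have hS : birkhoff f (fun x => t * φ₁ x + (1 - t) * φ₂ x) n x =
        t * (K - A + birkhoff f φ₁ n x) + (1 - t) * (K - B + birkhoff f φ₂ n x) := by
      simp only [birkhoff, Finset.sum_add_distrib, ← Finset.mul_sum]
      rw [hK]
      ring
    have := convexOn_exp.2 (Set.mem_univ (K - A + birkhoff f φ₁ n x))
      (Set.mem_univ (K - B + birkhoff f φ₂ n x)) ht₀ ht₁ (by ring)
    simp only [smul_eq_mul] at this
    rw [hS]
    refine this.trans_eq ?_
    rw [hu, hv, Real.exp_add, Real.exp_add]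
    ring
  calc _ ≤ ∑' n : s, ∑ x ∈ E n,
        (ENNReal.ofReal u * ENNReal.ofReal (Real.exp (birkhoff f φ₁ n x)) +
          ENNReal.ofReal v * ENNReal.ofReal (Real.exp (birkhoff f φ₂ n x))) :=
        ENNReal.tsum_le_tsum fun n => Finset.sum_le_sum fun x _ => key n x
    _ = ENNReal.ofReal u *
          (∑' n : s, ∑ x ∈ E n, ENNReal.ofReal (Real.exp (birkhoff f φ₁ n x))) +
        ENNReal.ofReal v *
          (∑' n : s, ∑ x ∈ E n, ENNReal.ofReal (Real.exp (birkhoff f φ₂ n x))) := by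
        simp only [Finset.sum_add_distrib, ← Finset.mul_sum, ENNReal.tsum_add,
          ENNReal.tsum_mul_left]
    _ ≤ ENNReal.ofReal u * ENNReal.ofReal (Real.exp A) +
        ENNReal.ofReal v * ENNReal.ofReal (Real.exp B) := by gcongr
    _ = ENNReal.ofReal (Real.exp K) := by
        rw [← ENNReal.ofReal_mul hu₀, ← ENNReal.ofReal_mul hv₀,
          ← ENNReal.ofReal_add (by positivity) (by positivity)]
        congr 1
        rw [hu, hv, mul_assoc, mul_assoc, ← Real.exp_add, ← Real.exp_add]
        simp only [sub_add_cancel]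
        ring

/-- Convexity at a finite scale: the growth rate of `Q` at scale `ε` is controlled by the growth
rates at scale `ε / 2`. -/
theorem inducedQ_convexCombination_le {X : Type*} [MetricSpace X] {f : X → X}
    {ψ φ₁ φ₂ : X → ℝ} {T ε c η a b t : ℝ} (ht : t ∈ Set.Icc (0 : ℝ) 1) (hε : 0 < ε)
    (hc : ∀ x, c ≤ ψ x) (hη : 0 ≤ η)
    (hφ₁ : ∀ x y, dist x y ≤ ε / 2 → dist (φ₁ x) (φ₁ y) ≤ η * c)
    (hφ₂ : ∀ x y, dist x y ≤ ε / 2 → dist (φ₂ x) (φ₂ y) ≤ η * c)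
    (h₁ : inducedQ f ψ φ₁ T (ε / 2) < ENNReal.ofReal (Real.exp (a * T)))
    (h₂ : inducedQ f ψ φ₂ T (ε / 2) < ENNReal.ofReal (Real.exp (b * T))) :
    inducedQ f ψ (fun x => t * φ₁ x + (1 - t) * φ₂ x) T ε ≤
      ENNReal.ofReal (Real.exp ((t * a + (1 - t) * b + η) * T)) := by
  simp only [inducedQ, iInf_lt_iff] at h₁ h₂
  obtain ⟨F, hF, hFa⟩ := h₁
  obtain ⟨G, hG, hGb⟩ := h₂
  have hex (n : ℕ) : n ∈ inducedST f ψ T → ∃ E : Finset X,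
      IsSeparatedSetOf f n ε (inducedXn f ψ T n) E ∧
        IsSpanningSetOf f n ε (inducedXn f ψ T n) E :=
    fun hn => (hF n hn).exists_separated hε
  choose! E hsep hspan using hex
  have hA := (tsum_separated_le hc hη hφ₁ hsep hF).trans (mul_le_mul_right hFa.le _)
  have hB := (tsum_separated_le hc hη hφ₂ hsep hG).trans (mul_le_mul_right hGb.le _)
  rw [← ENNReal.ofReal_mul (Real.exp_nonneg _), ← Real.exp_add] at hA hB
  refine (iInf₂_le E hspan).trans ((tsum_exp_convexCombination_le ht _ E hA hB).trans_eq ?_)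
  congr 2
  ring

theorem lt_ofReal_exp_of_log_mul_inv_lt {q : ℝ≥0∞} {a T : ℝ} (hT : 0 < T)
    (h : ENNReal.log q * ((T⁻¹ : ℝ) : EReal) < a) : q < ENNReal.ofReal (Real.exp (a * T)) := by
  contrapose! h
  have := ENNReal.log_monotone h
  rw [ENNReal.log_ofReal_of_pos (Real.exp_pos _), Real.log_exp] at this
  calc (a : EReal) = ((a * T : ℝ) : EReal) * ((T⁻¹ : ℝ) : EReal) := by
        rw [← EReal.coe_mul, mul_inv_cancel_right₀ hT.ne']
    _ ≤ _ := mul_le_mul_of_nonneg_right this (EReal.coe_nonneg.2 (inv_nonneg.2 hT.le))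

theorem log_mul_inv_le_of_le_ofReal_exp {q : ℝ≥0∞} {a T : ℝ} (hT : 0 < T)
    (h : q ≤ ENNReal.ofReal (Real.exp (a * T))) :
    ENNReal.log q * ((T⁻¹ : ℝ) : EReal) ≤ a := by
  have := ENNReal.log_monotone h
  rw [ENNReal.log_ofReal_of_pos (Real.exp_pos _), Real.log_exp] at this
  calc _ ≤ ((a * T : ℝ) : EReal) * ((T⁻¹ : ℝ) : EReal) :=
        mul_le_mul_of_nonneg_right this (EReal.coe_nonneg.2 (inv_nonneg.2 hT.le))
    _ = a := by rw [← EReal.coe_mul, mul_inv_cancel_right₀ hT.ne']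

theorem eventually_dist_le_of_continuous {X : Type*} [MetricSpace X] [CompactSpace X]
    {φ : X → ℝ} (hφ : Continuous φ) {δ : ℝ} (hδ : 0 < δ) :
    ∀ᶠ ε in 𝓝[>] (0 : ℝ), ∀ x y, dist x y ≤ ε / 2 → dist (φ x) (φ y) ≤ δ := by
  obtain ⟨r, hr, h⟩ := Metric.uniformContinuous_iff.1
    (CompactSpace.uniformContinuous_of_continuous hφ) δ hδ
  filter_upwards [Ioo_mem_nhdsGT hr] with ε hε x y hxy
  exact (h (by linarith [hε.1, hε.2])).le

theorem exists_pos_le_of_continuous {X : Type*} [TopologicalSpace X] [CompactSpace X]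
    {ψ : X → ℝ} (hψ : Continuous ψ) (hpos : ∀ x, 0 < ψ x) : ∃ c > 0, ∀ x, c ≤ ψ x := by
  rcases isEmpty_or_nonempty X with _ | _
  · exact ⟨1, one_pos, fun x => isEmptyElim x⟩
  · obtain ⟨x, hx⟩ := hψ.exists_forall_le_of_hasCompactSupport
      (HasCompactSupport.of_compactSpace ψ)
    exact ⟨ψ x, hpos x, hx⟩

theorem inducedPressure_convexCombination_le {X : Type*} [MetricSpace X] [CompactSpace X]
    {f : X → X} {ψ φ₁ φ₂ : X → ℝ} (hψ : Continuous ψ) (hψpos : ∀ x, 0 < ψ x)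
    (hφ₁ : Continuous φ₁) (hφ₂ : Continuous φ₂) {t a b : ℝ} (ht : t ∈ Set.Icc (0 : ℝ) 1)
    (ha : inducedPressure f ψ φ₁ < a) (hb : inducedPressure f ψ φ₂ < b) :
    inducedPressure f ψ (fun x => t * φ₁ x + (1 - t) * φ₂ x) ≤
      ((t * a + (1 - t) * b : ℝ) : EReal) := by
  obtain ⟨c, hc, hcψ⟩ := exists_pos_le_of_continuous hψ hψpos
  have hhalf : Tendsto (fun ε : ℝ => ε / 2) (𝓝[>] 0) (𝓝[>] 0) := by
    refine tendsto_nhdsWithin_iff.2 ⟨?_, ?_⟩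
    · simpa using (tendsto_id.div_const (2 : ℝ) : Tendsto _ (𝓝 (0 : ℝ)) _).mono_left
        nhdsWithin_le_nhds
    · filter_upwards [self_mem_nhdsWithin] with ε hε using half_pos (mem_Ioi.1 hε)
  refine EReal.le_of_forall_lt_iff_le.1 fun z hz => ?_
  obtain ⟨η, hη, rfl⟩ : ∃ η > 0, z = t * a + (1 - t) * b + η :=
    ⟨z - (t * a + (1 - t) * b), sub_pos.2 (EReal.coe_lt_coe_iff.1 hz), by ring⟩
  refine limsup_le_of_le (by isBoundedDefault) ?_
  filter_upwards [hhalf.eventually (eventually_lt_of_limsup_lt ha),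
    hhalf.eventually (eventually_lt_of_limsup_lt hb),
    eventually_dist_le_of_continuous hφ₁ (mul_pos hη hc),
    eventually_dist_le_of_continuous hφ₂ (mul_pos hη hc), self_mem_nhdsWithin]
    with ε hεa hεb h₁ h₂ hε
  refine limsup_le_of_le (by isBoundedDefault) ?_
  filter_upwards [eventually_lt_of_limsup_lt hεa, eventually_lt_of_limsup_lt hεb,
    eventually_gt_atTop 0] with T hTa hTb hT
  exact log_mul_inv_le_of_le_ofReal_exp hT <|
    inducedQ_convexCombination_le ht hε hcψ hη.le h₁ h₂
      (lt_ofReal_exp_of_log_mul_inv_lt hT hTa) (lt_ofReal_exp_of_log_mul_inv_lt hT hTb)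

theorem le_convexCombination_of_forall_lt {p q r : EReal} {t : ℝ}
    (ht : t ∈ Set.Ioo (0 : ℝ) 1) (hp : p < ⊤) (hq : q < ⊤)
    (h : ∀ a b : ℝ, p < a → q < b → r ≤ ((t * a + (1 - t) * b : ℝ) : EReal)) :
    r ≤ (t : EReal) * p + ((1 - t : ℝ) : EReal) * q := by
  have ht₀ := ht.1
  have ht₁ : 0 < 1 - t := sub_pos.2 ht.2
  obtain ⟨a, hpa, -⟩ := EReal.lt_iff_exists_real_btwn.1 hp
  obtain ⟨b, hqb, -⟩ := EReal.lt_iff_exists_real_btwn.1 hq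
  induction p with
  | top => exact absurd hp (lt_irrefl _)
  | bot =>
    refine le_trans (EReal.le_of_forall_lt_iff_le.1 fun z _ => ?_) bot_le
    refine (h ((z - (1 - t) * b) / t) b (EReal.bot_lt_coe _) hqb).trans_eq ?_
    congr 1
    field_simp
    ring
  | coe p =>
    induction q with
    | top => exact absurd hq (lt_irrefl _)
    | bot =>
      refine le_trans (EReal.le_of_forall_lt_iff_le.1 fun z _ => ?_) bot_le
      refine (h a ((z - t * a) / (1 - t)) hpa (EReal.bot_lt_coe _)).trans_eq ?_
      congr 1
      field_simp
      ring
    | coe q =>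
      rw [← EReal.coe_mul, ← EReal.coe_mul, ← EReal.coe_add]
      refine EReal.le_of_forall_lt_iff_le.1 fun z hz => ?_
      have hz := EReal.coe_lt_coe_iff.1 hz
      set e := z - (t * p + (1 - t) * q) with he
      have he₀ : 0 < e := sub_pos.2 hz
      refine (h (p + e) (q + e) ?_ ?_).trans_eq ?_
      · exact EReal.coe_lt_coe_iff.2 (lt_add_of_pos_right _ he₀)
      · exact EReal.coe_lt_coe_iff.2 (lt_add_of_pos_right _ he₀)
      · congr 1
        rw [he]
        ring

/-- If `P_ψ(φ) < ∞` for every continuous `φ`, then the induced pressure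
functional is convex: `P_ψ(tφ₁ + (1-t)φ₂) ≤ t P_ψ(φ₁) + (1-t) P_ψ(φ₂)` for `t ∈ [0,1]`. -/
theorem inducedPressure_convex
    {X : Type*} [MetricSpace X] [CompactSpace X]
    (f : X → X) (hf : Continuous f)
    (ψ : X → ℝ) (hψ : Continuous ψ) (hψpos : ∀ x, 0 < ψ x)
    (hfin : ∀ φ : X → ℝ, Continuous φ → inducedPressure f ψ φ < ⊤) :
    ∀ φ₁ φ₂ : X → ℝ, Continuous φ₁ → Continuous φ₂ → ∀ t ∈ Set.Icc (0 : ℝ) 1,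
      inducedPressure f ψ (fun x => t * φ₁ x + (1 - t) * φ₂ x) ≤
        ((t : ℝ) : EReal) * inducedPressure f ψ φ₁ +
          (((1 - t : ℝ)) : EReal) * inducedPressure f ψ φ₂ := by
  intro φ₁ φ₂ hφ₁ hφ₂ t ht
  rcases ht.1.eq_or_lt with rfl | ht₀
  · simp
  rcases ht.2.eq_or_lt with rfl | ht₁
  · simp
  exact le_convexCombination_of_forall_lt ⟨ht₀, ht₁⟩ (hfin φ₁ hφ₁) (hfin φ₂ hφ₂)
    fun a b ha hb => inducedPressure_convexCombination_le hψ hψpos hφ₁ hφ₂ ht ha hb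
end

section
/- Let (X,d) be a compact metric space, f : X → X continuous with h_top(f) < +∞, ψ ∈ C(X,ℝ) with ψ > 0, and μ₀ ∈ M(X,f). If h_{μ₀}(f) = inf{P_ψ(φ) · ∫ψ dμ₀ − ∫φ dμ₀ : φ ∈ C(X,ℝ)}, then the entropy map μ ↦ h_μ(f) on M(X,f) (with the weak* topology) is upper semi-continuous at μ₀. -/
open Filter Set Topology MeasureTheory ENNReal

variable {X : Type*}

section Meas
variable [MetricSpace X] [MeasurableSpace X] [BorelSpace X]

/-- Entropy of the finite measurable partition of `X` induced by a map `q` into a finite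
type: `H(q) = ∑_s -μ(q⁻¹{s}) log μ(q⁻¹{s})`. -/
noncomputable def mapEntropy {S : Type*} [Fintype S] (μ : Measure X) (q : X → S) : ℝ :=
  ∑ s : S, Real.negMulLog ((μ (q ⁻¹' {s})).toReal)

/-- Kolmogorov–Sinai (measure-theoretic) entropy `h_μ(f)`: the supremum, over finite
measurable partitions (encoded as measurable maps `p : X → Fin k`), of
`lim_n (1/n) H(⋁_{i<n} f^{-i} p)`; the limit exists by subadditivity and is
realized here as a `liminf`. -/
noncomputable def measEntropy (f : X → X) (μ : Measure X) : EReal :=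
  ⨆ (k : ℕ) (p : X → Fin k) (_ : Measurable p),
    liminf (fun n : ℕ =>
      (((n : ℝ)⁻¹ * mapEntropy μ (fun x (i : Fin n) => p (f^[i] x)) : ℝ) : EReal)) atTop

/-- The set `M(X,f)` of `f`-invariant Borel probability measures on `X`. -/
def invMeasures (f : X → X) : Set (Measure X) :=
  {μ | IsProbabilityMeasure μ ∧ ∀ B : Set X, MeasurableSet B → μ (f ⁻¹' B) = μ B}

/-- `μ` is an equilibrium state of `P_ψ(φ)`:
`μ ∈ M(X,f)` and `P_ψ(φ) = (h_μ(f) + ∫φ dμ)/(∫ψ dμ)`. -/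
noncomputable def equilibriumStates (f : X → X) (ψ φ : X → ℝ) : Set (Measure X) :=
  {μ | μ ∈ invMeasures f ∧
    inducedPressure f ψ φ =
      (measEntropy f μ + ((∫ x, φ x ∂μ : ℝ) : EReal)) / (((∫ x, ψ x ∂μ : ℝ) : EReal))}

end Meas

theorem eventually_exists_spanning_sum_le [MetricSpace X] {f : X → X} {ψ φ : X → ℝ} {β : ℝ}
    (h : inducedPressure f ψ φ < β) :
    ∀ᶠ ε : ℝ in 𝓝[>] 0, ∀ᶠ T : ℝ in atTop, ∀ n, ∃ G : Finset X,
      IsSpanningSetOf f n ε (inducedXn f ψ T n) G ∧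
        ∑ x ∈ G, Real.exp (birkhoff f φ n x) ≤ Real.exp (β * T) := by
  filter_upwards [eventually_lt_of_limsup_lt h] with ε hε
  filter_upwards [eventually_lt_of_limsup_lt hε, eventually_gt_atTop 0] with T hT hT0 n
  have hQ : inducedQ f ψ φ T ε < ENNReal.ofReal (Real.exp (β * T)) := by
    by_contra! hle
    have h1 : ((β * T : ℝ) : EReal) ≤ ENNReal.log (inducedQ f ψ φ T ε) := by
      have := ENNReal.log_monotone hle
      rwa [ENNReal.log_ofReal, if_neg (Real.exp_pos _).not_ge, Real.log_exp] at this
    have h2 := mul_le_mul_of_nonneg_right h1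
      (show (0 : EReal) ≤ ((T⁻¹ : ℝ) : EReal) by exact_mod_cast (inv_pos.2 hT0).le)
    rw [← EReal.coe_mul, mul_assoc, mul_inv_cancel₀ hT0.ne', mul_one] at h2
    exact absurd hT h2.not_gt
  obtain ⟨F, hF⟩ := iInf_lt_iff.1 hQ
  obtain ⟨hspan, hsum⟩ := iInf_lt_iff.1 hF
  by_cases hn : n ∈ inducedST f ψ T
  · refine ⟨F n, hspan n hn, ?_⟩
    have h3 := (ENNReal.le_tsum (f := fun n : inducedST f ψ T =>
      ∑ x ∈ F n, ENNReal.ofReal (Real.exp (birkhoff f φ n x))) ⟨n, hn⟩).trans hsum.le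
    rw [← ENNReal.ofReal_sum_of_nonneg fun _ _ => (Real.exp_pos _).le] at h3
    exact (ENNReal.ofReal_le_ofReal_iff (Real.exp_pos _).le).1 h3
  · exact ⟨∅, fun y hy => absurd ⟨y, hy⟩ hn, by simpa using (Real.exp_pos _).le⟩

/-- Gibbs' inequality for the entropy of a finite partition. -/
theorem mapEntropy_le_log_add_integral [MetricSpace X] [MeasurableSpace X] [BorelSpace X]
    {S : Type*} [Fintype S] [MeasurableSpace S] [MeasurableSingletonClass S]
    {μ : Measure X} [IsProbabilityMeasure μ] {q : X → S} (hq : Measurable q)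
    {w : S → ℝ} {W : ℝ} (hw : ∀ s, 0 ≤ w s) (hW0 : 0 < W) (hW : ∑ s, w s ≤ W)
    {g : X → ℝ} (hg : Integrable g μ) (hgw : ∀ y, Real.exp (-g y) ≤ w (q y)) :
    mapEntropy μ q ≤ Real.log W + ∫ y, g y ∂μ := by
  have : IsProbabilityMeasure (μ.map q) := Measure.isProbabilityMeasure_map hq.aemeasurable
  have hint : ∫ y, -Real.log (w (q y)) ∂μ = ∑ s, (μ.map q).real {s} * -Real.log (w s) := by
    rw [← integral_map (φ := q) (f := fun s => -Real.log (w s)) hq.aemeasurable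
      (Measurable.of_discrete).aestronglyMeasurable, integral_fintype Integrable.of_finite]
    rfl
  have hle : ∫ y, -Real.log (w (q y)) ∂μ ≤ ∫ y, g y ∂μ := by
    refine integral_mono ?_ hg fun y => ?_
    · exact (Integrable.of_finite (μ := μ.map q)
        (f := fun s => -Real.log (w s))).comp_measurable hq
    · have := Real.log_le_log (Real.exp_pos _) (hgw y)
      rw [Real.log_exp] at this
      simp only
      linarith
  have htotal : ∑ s, (μ.map q).real {s} = 1 := by
    simp
  have hpt : ∀ s, Real.negMulLog (μ (q ⁻¹' {s})).toReal ≤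
      (μ.map q).real {s} * -Real.log (w s) + (μ.map q).real {s} * Real.log W
        + (w s / W - (μ.map q).real {s}) := by
    intro s
    have hm : (μ (q ⁻¹' {s})).toReal = (μ.map q).real {s} := by
      rw [Measure.real, Measure.map_apply hq (measurableSet_singleton s)]
    have hm0 : 0 ≤ (μ.map q).real {s} := measureReal_nonneg
    rw [hm]
    generalize (μ.map q).real {s} = m at hm hm0 ⊢
    rcases hm0.eq_or_lt with rfl | h0
    · simpa using div_nonneg (hw s) hW0.le
    · have hne : (q ⁻¹' {s}).Nonempty := by
        rw [nonempty_iff_ne_empty]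
        intro he
        rw [he] at hm
        simp at hm
        linarith
      obtain ⟨y, rfl⟩ := hne
      have hws : 0 < w (q y) := (Real.exp_pos _).trans_le (hgw y)
      have hlog := Real.log_le_sub_one_of_pos (x := w (q y) / W / m) (by positivity)
      rw [Real.log_div (by positivity) h0.ne', Real.log_div hws.ne' hW0.ne'] at hlog
      have hmul := mul_le_mul_of_nonneg_left hlog h0.le
      have : m * (w (q y) / W / m - 1) = w (q y) / W - m := by field_simp
      rw [this] at hmul
      rw [Real.negMulLog]
      linarith
  have hsum := Finset.sum_le_sum fun s (_ : s ∈ Finset.univ) => hpt s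
  rw [Finset.sum_add_distrib, Finset.sum_add_distrib, Finset.sum_sub_distrib, ← Finset.sum_mul,
    htotal, ← hint, ← Finset.sum_div] at hsum
  have : (∑ s, w s) / W ≤ 1 := (div_le_one hW0).2 hW
  rw [mapEntropy]
  linarith

theorem exists_transition_weights (k : ℕ) [NeZero k] {κ : ℝ} (hκ : 0 < κ) :
    ∃ c : ℝ, 0 ≤ c ∧ ∃ v : Fin k → Fin k → ℝ, (∀ a, ∑ b, v a b = 1) ∧
      (∀ a b, Real.exp (-c) ≤ v a b) ∧ ∀ a, Real.exp (-κ) ≤ v a a := by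
  have hk : (0 : ℝ) < k := by exact_mod_cast Nat.pos_of_ne_zero (NeZero.ne k)
  have hexp : Real.exp (-κ) < 1 := by rw [Real.exp_lt_one_iff]; linarith
  have hpos : 0 < (1 - Real.exp (-κ)) / k := div_pos (by linarith) hk
  refine ⟨|Real.log ((1 - Real.exp (-κ)) / k)|, abs_nonneg _,
    fun a b => (if a = b then Real.exp (-κ) else 0) + (1 - Real.exp (-κ)) / k, ?_, ?_, ?_⟩
  · intro a
    rw [Finset.sum_add_distrib]
    simp
    field_simp
    ring
  · intro a b
    have : Real.exp (-|Real.log ((1 - Real.exp (-κ)) / k)|) ≤ (1 - Real.exp (-κ)) / k := by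
      rw [← Real.le_log_iff_exp_le hpos]
      exact neg_abs_le _
    simp only
    split_ifs
    · linarith [Real.exp_pos (-κ)]
    · linarith
  · intro a
    simp only [if_true]
    linarith

/-- Outside a set of small measure, a finite measurable partition is determined at a fixed
scale. -/
theorem exists_small_set_eventually_labelling [MetricSpace X] [MeasurableSpace X] [BorelSpace X]
    (μ : Measure X) [IsFiniteMeasure μ] [CompactSpace X] {k : ℕ} {p : X → Fin k}
    (hp : Measurable p) {η : ℝ} (hη : 0 < η) :
    ∃ B : Set X, MeasurableSet B ∧ μ.real B ≤ η ∧
      ∀ᶠ ε : ℝ in 𝓝[>] 0, ∃ r : X → Fin k, ∀ x y, dist x y ≤ ε → y ∉ B → r x = p y := by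
  classical
  have hK : ∀ j : Fin k, ∃ K ⊆ p ⁻¹' {j}, IsClosed K ∧
      μ (p ⁻¹' {j} \ K) < ENNReal.ofReal (η / k) := fun j =>
    (hp (measurableSet_singleton j)).exists_isClosed_sdiff_lt (measure_ne_top _ _)
      (ENNReal.ofReal_pos.2 (div_pos hη (by
        exact_mod_cast (Nat.zero_le _).trans_lt j.isLt))).ne'
  choose K hKp hKc hKμ using hK
  refine ⟨⋃ j, p ⁻¹' {j} \ K j, .iUnion fun j =>
    (hp (measurableSet_singleton j)).diff (hKc j).measurableSet, ?_, ?_⟩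
  · refine (measureReal_iUnion_fintype_le _).trans ?_
    have hterm : ∀ j ∈ Finset.univ, μ.real (p ⁻¹' {j} \ K j) ≤ η / k := fun j _ =>
      ENNReal.toReal_le_of_le_ofReal (by positivity) (hKμ j).le
    refine (Finset.sum_le_sum hterm).trans ?_
    rcases k.eq_zero_or_pos with rfl | hk
    · simpa using hη.le
    · have : (0 : ℝ) < k := by exact_mod_cast hk
      simp
      field_simp
      exact le_rfl
  · have hsep : ∀ᶠ ε : ℝ in 𝓝[>] 0, ∀ i j, i ≠ j →
        ∀ x, ∀ y ∈ K i, ∀ z ∈ K j, dist x y ≤ ε → ε < dist x z := by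
      rw [eventually_all]
      intro i
      rw [eventually_all]
      intro j
      rw [eventually_imp_distrib_left]
      intro hij
      have hd : Disjoint (K i) (K j) := Disjoint.mono (hKp i) (hKp j)
        (disjoint_left.2 fun x hx hy => hij (hx.symm.trans hy))
      obtain ⟨δ, hδ, hdis⟩ := hd.exists_thickenings (hKc i).isCompact (hKc j)
      filter_upwards [Ioo_mem_nhdsGT hδ] with ε hε x y hy z hz hxy
      by_contra! hxz
      exact disjoint_left.1 hdis (Metric.mem_thickening_iff.2 ⟨y, hy, hxy.trans_lt hε.2⟩)
        (Metric.mem_thickening_iff.2 ⟨z, hz, hxz.trans_lt hε.2⟩)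
    filter_upwards [hsep] with ε hε
    refine ⟨fun x => if h : ∃ j, ∃ z ∈ K j, dist x z ≤ ε then h.choose else p x, ?_⟩
    intro x y hxy hy
    have hyK : y ∈ K (p y) := by
      by_contra hn
      exact hy (mem_iUnion.2 ⟨p y, rfl, hn⟩)
    have h : ∃ j, ∃ z ∈ K j, dist x z ≤ ε := ⟨p y, y, hyK, hxy⟩
    simp only [dif_pos h]
    obtain ⟨z, hz, hxz⟩ := h.choose_spec
    by_contra hne
    exact (hε _ _ hne x z hz y hyK hxz).not_ge hxy

theorem exists_nat_mem_inducedXn {X : Type*} [MetricSpace X] {f : X → X} {ψ : X → ℝ} {τ : ℝ}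
    (hτ : 0 < τ) (hψτ : ∀ x, τ ≤ ψ x) {L : ℕ} (hψL : ∀ x, ψ x ≤ τ * L) (n : ℕ) (y : X) :
    ∃ j ∈ Finset.Ico n ((n + 1) * L), y ∈ inducedXn f ψ (τ * j) n := by
  have hlow : n * τ ≤ birkhoff f ψ n y := by
    have := Finset.card_nsmul_le_sum (Finset.range n) (fun i => ψ (f^[i] y)) τ fun i _ => hψτ _
    simpa [birkhoff] using this
  have hup : birkhoff f ψ (n + 1) y ≤ (n + 1) * (τ * L) := by
    have := Finset.sum_le_card_nsmul (Finset.range (n + 1)) (fun i => ψ (f^[i] y)) (τ * L)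
      fun i _ => hψL _
    simpa [birkhoff] using this
  have hstep : birkhoff f ψ (n + 1) y = birkhoff f ψ n y + ψ (f^[n] y) := by
    simp [birkhoff, Finset.sum_range_succ]
  have h0 : 0 ≤ birkhoff f ψ n y := le_trans (by positivity) hlow
  set j := ⌈birkhoff f ψ n y / τ⌉₊ with hj
  have hj1 : birkhoff f ψ n y ≤ τ * j := by
    have := Nat.le_ceil (birkhoff f ψ n y / τ)
    rw [div_le_iff₀ hτ] at this
    linarith
  have hj2 : τ * j < birkhoff f ψ (n + 1) y := by
    have := Nat.ceil_lt_add_one (div_nonneg h0 hτ.le)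
    rw [← hj, ← sub_lt_iff_lt_add, lt_div_iff₀ hτ] at this
    linarith [hψτ (f^[n] y)]
  refine ⟨j, Finset.mem_Ico.2 ⟨?_, ?_⟩, hj1, hj2⟩
  · have : (n : ℝ) * τ ≤ j * τ := by linarith
    exact_mod_cast le_of_mul_le_mul_right this hτ
  · have : τ * (j : ℝ) < τ * ((n + 1) * L) := by linarith
    exact_mod_cast lt_of_mul_lt_mul_left this hτ.le

/-- Weights on itineraries built from spanning sets of the sets `X_n`, `n` fixed, at the levels
`T = τ * j`. -/
theorem exists_itinerary_weights {X : Type*} [MetricSpace X] {f : X → X} {ψ φ : X → ℝ} {τ : ℝ}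
    (hτ : 0 < τ) (hψτ : ∀ x, τ ≤ ψ x) {L : ℕ} (hψL : ∀ x, ψ x ≤ τ * L)
    {β ε κ c : ℝ} {n k : ℕ} {G : ℕ → Finset X}
    (hspan : ∀ j, n ≤ j → IsSpanningSetOf f n ε (inducedXn f ψ (τ * j) n) (G j))
    (hsum : ∀ j, n ≤ j → ∑ x ∈ G j, Real.exp (birkhoff f φ n x) ≤ Real.exp (β * (τ * j)))
    (hφ : ∀ x y, dist x y ≤ ε → φ y - κ ≤ φ x)
    {p r : X → Fin k} {B : Set X} (hr : ∀ x y, dist x y ≤ ε → y ∉ B → r x = p y)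
    {v : Fin k → Fin k → ℝ} (hv1 : ∀ a, ∑ b, v a b = 1) (hκ : 0 ≤ κ)
    (hvc : ∀ a b, Real.exp (-c) ≤ v a b) (hvκ : ∀ a, Real.exp (-κ) ≤ v a a) :
    ∃ w : (Fin n → Fin k) → ℝ, (∀ s, 0 ≤ w s) ∧ ∑ s, w s ≤ ((n + 1) * L : ℕ) ∧
      ∀ y, Real.exp (-(|β| * (τ * L) + ∑ i ∈ Finset.range n,
          (β * ψ (f^[i] y) - φ (f^[i] y) + 2 * κ + B.indicator (fun _ => c) (f^[i] y)))) ≤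
        w (fun i => p (f^[i] y)) := by
  have hv0 : ∀ a b, 0 ≤ v a b := fun a b => (Real.exp_pos _).le.trans (hvc a b)
  have hterm : ∀ (j : ℕ) (x : X) (s : Fin n → Fin k), 0 ≤ Real.exp (-(β * (τ * j))) *
      (Real.exp (birkhoff f φ n x) * ∏ i : Fin n, v (r (f^[i] x)) (s i)) := fun j x s =>
    mul_nonneg (Real.exp_pos _).le (mul_nonneg (Real.exp_pos _).le
      (Finset.prod_nonneg fun _ _ => hv0 _ _))
  refine ⟨fun s => ∑ j ∈ Finset.Ico n ((n + 1) * L), ∑ x ∈ G j, Real.exp (-(β * (τ * j))) *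
      (Real.exp (birkhoff f φ n x) * ∏ i : Fin n, v (r (f^[i] x)) (s i)),
    fun s => Finset.sum_nonneg fun j _ => Finset.sum_nonneg fun x _ => hterm j x s, ?_, ?_⟩
  · rw [Finset.sum_comm]
    have hlevel : ∀ j ∈ Finset.Ico n ((n + 1) * L), ∑ s : Fin n → Fin k, ∑ x ∈ G j,
        Real.exp (-(β * (τ * j))) *
          (Real.exp (birkhoff f φ n x) * ∏ i : Fin n, v (r (f^[i] x)) (s i)) ≤ 1 := by
      intro j hj
      rw [Finset.sum_comm]
      have hprod : ∀ x : X, ∑ s : Fin n → Fin k, ∏ i : Fin n, v (r (f^[i] x)) (s i) = 1 := by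
        intro x
        rw [← Fintype.piFinset_univ,
          Finset.sum_prod_piFinset Finset.univ fun (i : Fin n) b => v (r (f^[i] x)) b]
        simp [hv1]
      simp_rw [← Finset.mul_sum, hprod, mul_one]
      calc _ ≤ Real.exp (-(β * (τ * j))) * Real.exp (β * (τ * j)) :=
            mul_le_mul_of_nonneg_left (hsum j (Finset.mem_Ico.1 hj).1) (Real.exp_pos _).le
        _ = 1 := by rw [← Real.exp_add]; simp
    refine (Finset.sum_le_card_nsmul _ _ 1 hlevel).trans ?_
    rw [nsmul_eq_mul, mul_one, Nat.card_Ico]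
    exact_mod_cast Nat.sub_le _ _
  · intro y
    obtain ⟨j, hj, hyT⟩ := exists_nat_mem_inducedXn (f := f) hτ hψτ hψL n y
    obtain ⟨x, hx, hxy⟩ := hspan j (Finset.mem_Ico.1 hj).1 y hyT
    refine le_trans ?_ ((Finset.single_le_sum
      (fun x _ => hterm j x fun i => p (f^[i] y)) hx).trans (Finset.single_le_sum
      (f := fun j => ∑ x ∈ G j, Real.exp (-(β * (τ * j))) * (Real.exp (birkhoff f φ n x) *
        ∏ i : Fin n, v (r (f^[i] x)) (p (f^[i] y))))
      (fun j _ => Finset.sum_nonneg fun x _ => hterm j x fun i => p (f^[i] y)) hj))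
    have hT : β * (τ * j) ≤ |β| * (τ * L) + β * birkhoff f ψ n y := by
      have h1 : τ * j - birkhoff f ψ n y ≤ τ * L := by
        have hstep : birkhoff f ψ (n + 1) y = birkhoff f ψ n y + ψ (f^[n] y) := by
          simp [birkhoff, Finset.sum_range_succ]
        linarith [hyT.2, hψL (f^[n] y)]
      have h2 : β * (τ * j - birkhoff f ψ n y) ≤ |β| * (τ * L) :=
        (mul_le_mul_of_nonneg_right (le_abs_self β) (sub_nonneg.2 hyT.1)).trans
          (mul_le_mul_of_nonneg_left h1 (abs_nonneg β))
      linarith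
    have hφsum : birkhoff f φ n y - n * κ ≤ birkhoff f φ n x := by
      have := Finset.sum_le_sum fun i (hi : i ∈ Finset.range n) =>
        hφ _ _ (hxy i (Finset.mem_range.1 hi))
      simpa [birkhoff, Finset.sum_sub_distrib] using this
    have hvprod : Real.exp (∑ i ∈ Finset.range n, -(κ + B.indicator (fun _ => c) (f^[i] y))) ≤
        ∏ i : Fin n, v (r (f^[i] x)) (p (f^[i] y)) := by
      rw [Real.exp_sum, ← Fin.prod_univ_eq_prod_range
        (fun i => Real.exp (-(κ + B.indicator (fun _ => c) (f^[i] y))))]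
      refine Finset.prod_le_prod (fun _ _ => (Real.exp_pos _).le) fun i _ => ?_
      by_cases hB : f^[i] y ∈ B
      · rw [indicator_of_mem hB]
        exact (Real.exp_le_exp.2 (by linarith)).trans (hvc _ _)
      · rw [indicator_of_notMem hB, add_zero, hr _ _ (hxy i i.isLt) hB]
        exact hvκ _
    refine le_trans ?_ (mul_le_mul_of_nonneg_left (mul_le_mul_of_nonneg_left hvprod
      (Real.exp_pos _).le) (Real.exp_pos _).le)
    rw [← Real.exp_add, ← Real.exp_add, Real.exp_le_exp]
    simp only [Finset.sum_add_distrib, Finset.sum_sub_distrib, Finset.sum_neg_distrib,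
      ← Finset.mul_sum, Finset.sum_const, Finset.card_range, nsmul_eq_mul]
    simp only [birkhoff] at hT hφsum ⊢
    linarith

theorem mapEntropy_itinerary_le {X : Type*} [MetricSpace X] [CompactSpace X] [Nonempty X]
    [MeasurableSpace X] [BorelSpace X] {f : X → X} {μ : Measure X} [IsProbabilityMeasure μ]
    (hμ : MeasurePreserving f μ μ) {ψ φ : X → ℝ} (hψ : Continuous ψ) (hφc : Continuous φ) {τ : ℝ}
    (hτ : 0 < τ) (hψτ : ∀ x, τ ≤ ψ x) {L : ℕ} (hψL : ∀ x, ψ x ≤ τ * L)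
    {β ε κ c : ℝ} {n k : ℕ} {G : ℕ → Finset X}
    (hspan : ∀ j, n ≤ j → IsSpanningSetOf f n ε (inducedXn f ψ (τ * j) n) (G j))
    (hsum : ∀ j, n ≤ j → ∑ x ∈ G j, Real.exp (birkhoff f φ n x) ≤ Real.exp (β * (τ * j)))
    (hφ : ∀ x y, dist x y ≤ ε → φ y - κ ≤ φ x)
    {p r : X → Fin k} (hp : Measurable p) {B : Set X} (hB : MeasurableSet B)
    (hr : ∀ x y, dist x y ≤ ε → y ∉ B → r x = p y)
    {v : Fin k → Fin k → ℝ} (hv1 : ∀ a, ∑ b, v a b = 1) (hκ : 0 ≤ κ)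
    (hvc : ∀ a b, Real.exp (-c) ≤ v a b) (hvκ : ∀ a, Real.exp (-κ) ≤ v a a) :
    mapEntropy μ (fun x (i : Fin n) => p (f^[i] x)) ≤
      Real.log ((n + 1) * L) + |β| * (τ * L) +
        n * (β * ∫ x, ψ x ∂μ - ∫ x, φ x ∂μ + 2 * κ + c * μ.real B) := by
  obtain ⟨w, hw0, hw, hwy⟩ :=
    exists_itinerary_weights hτ hψτ hψL hspan hsum hφ hr hv1 hκ hvc hvκ
  have hL : 0 < L := by
    obtain ⟨x⟩ := ‹Nonempty X›
    have : 0 < τ * L := hτ.trans_le ((hψτ x).trans (hψL x))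
    exact_mod_cast pos_of_mul_pos_right this hτ.le
  have hψi : Integrable ψ μ := hψ.integrable_of_hasCompactSupport (.of_compactSpace ψ)
  have hφi : Integrable φ μ := hφc.integrable_of_hasCompactSupport (.of_compactSpace φ)
  have hBi : Integrable (B.indicator fun _ => c) μ := (integrable_const c).indicator hB
  have hψφi : Integrable (fun y => β * ψ y - φ y) μ := (hψi.const_mul β).sub hφi
  have hψφκi : Integrable (fun y => β * ψ y - φ y + 2 * κ) μ := hψφi.add (integrable_const _)
  have hui : Integrable (fun y => β * ψ y - φ y + 2 * κ + B.indicator (fun _ => c) y) μ :=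
    hψφκi.add hBi
  have hu : ∫ y, (β * ψ y - φ y + 2 * κ + B.indicator (fun _ => c) y) ∂μ =
      β * ∫ x, ψ x ∂μ - ∫ x, φ x ∂μ + 2 * κ + c * μ.real B := by
    rw [integral_add hψφκi hBi, integral_add hψφi (integrable_const _),
      integral_sub (hψi.const_mul β) hφi, integral_const_mul, integral_indicator_const _ hB]
    simp [mul_comm]
  have huf : ∀ i, Integrable (fun y => β * ψ (f^[i] y) - φ (f^[i] y) + 2 * κ +
      B.indicator (fun _ => c) (f^[i] y)) μ := fun i =>
    (hμ.iterate i).integrable_comp_of_integrable hui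
  have hufi : ∀ i, ∫ y, (β * ψ (f^[i] y) - φ (f^[i] y) + 2 * κ +
      B.indicator (fun _ => c) (f^[i] y)) ∂μ =
      β * ∫ x, ψ x ∂μ - ∫ x, φ x ∂μ + 2 * κ + c * μ.real B := by
    intro i
    rw [← hu]
    conv_rhs => rw [← (hμ.iterate i).map_eq]
    rw [integral_map (hμ.iterate i).measurable.aemeasurable]
    rw [(hμ.iterate i).map_eq]
    exact hui.aestronglyMeasurable
  have key := mapEntropy_le_log_add_integral (μ := μ)
    (q := fun x (i : Fin n) => p (f^[i] x))
    (measurable_pi_lambda _ fun i => hp.comp (hμ.measurable.iterate i)) hw0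
    (by positivity) hw ((integrable_const _).add (integrable_finsetSum _ fun i _ => huf i)) hwy
  refine key.trans_eq ?_
  rw [integral_add' (integrable_const _) (integrable_finsetSum _ fun i _ => huf i),
    integral_finsetSum _ fun i _ => huf i]
  simp only [hufi]
  simp
  ring

/-- The upper half of the variational principle for the induced pressure. -/
theorem measEntropy_le_of_inducedPressure_lt {X : Type*} [MetricSpace X] [CompactSpace X]
    [Nonempty X] [MeasurableSpace X] [BorelSpace X] {f : X → X} (hf : Continuous f)
    {ψ φ : X → ℝ} (hψ : Continuous ψ) (hψpos : ∀ x, 0 < ψ x) (hφ : Continuous φ) {β : ℝ}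
    (hβ : inducedPressure f ψ φ < β) {μ : Measure X} (hμ : μ ∈ invMeasures f) :
    measEntropy f μ ≤ ((β * ∫ x, ψ x ∂μ - ∫ x, φ x ∂μ : ℝ) : EReal) := by
  have := hμ.1
  have hpres : MeasurePreserving f μ μ :=
    ⟨hf.measurable, Measure.ext fun s hs => by rw [Measure.map_apply hf.measurable hs, hμ.2 s hs]⟩
  obtain ⟨x₀, hx₀⟩ := hψ.exists_forall_le_of_hasCompactSupport (.of_compactSpace ψ)
  obtain ⟨x₁, hx₁⟩ := hψ.exists_forall_ge_of_hasCompactSupport (.of_compactSpace ψ)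
  have hτ := hψpos x₀
  set τ := ψ x₀
  obtain ⟨L, hL⟩ := exists_nat_ge (ψ x₁ / τ)
  have hψL : ∀ x, ψ x ≤ τ * L := fun x => (hx₁ x).trans (by rwa [div_le_iff₀' hτ] at hL)
  have hL0 : (0 : ℝ) < L := pos_of_mul_pos_right (hτ.trans_le (hψL x₀)) hτ.le
  refine iSup_le fun k => iSup_le fun p => iSup_le fun hp => ?_
  have : NeZero k := ⟨by rintro rfl; exact (p x₀).elim0⟩
  refine EReal.le_of_forall_lt_iff_le.1 fun z hz => ?_
  rw [EReal.coe_lt_coe_iff] at hz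
  obtain ⟨κ, hκ, hκz⟩ : ∃ κ > 0, β * ∫ x, ψ x ∂μ - ∫ x, φ x ∂μ + 4 * κ = z :=
    ⟨(z - (β * ∫ x, ψ x ∂μ - ∫ x, φ x ∂μ)) / 4, by linarith, by ring⟩
  obtain ⟨c, hc, v, hv1, hvc, hvκ⟩ := exists_transition_weights k hκ
  obtain ⟨B, hB, hBμ, hlabel⟩ := exists_small_set_eventually_labelling μ hp
    (show 0 < κ / (c + 1) by positivity)
  have hcB : c * μ.real B ≤ κ := by
    have := mul_le_mul_of_nonneg_left hBμ (show 0 ≤ c + 1 by positivity)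
    rw [mul_div_cancel₀ _ (by positivity)] at this
    nlinarith [measureReal_nonneg (μ := μ) (s := B)]
  have hunif : ∀ᶠ ε : ℝ in 𝓝[>] 0, ∀ x y, dist x y ≤ ε → φ y - κ ≤ φ x := by
    obtain ⟨δ, hδ, hδφ⟩ := Metric.uniformContinuous_iff.1
      (CompactSpace.uniformContinuous_of_continuous hφ) κ hκ
    filter_upwards [Ioo_mem_nhdsGT hδ] with ε hε x y hxy
    have := (abs_lt.1 (hδφ (hxy.trans_lt hε.2))).1
    linarith
  obtain ⟨ε, ⟨r, hr⟩, hεφ, hεT⟩ :=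
    (hlabel.and (hunif.and (eventually_exists_spanning_sum_le hβ))).exists
  obtain ⟨T₀, hT₀⟩ := eventually_atTop.1 hεT
  have hlim : Tendsto (fun n : ℕ => (n : ℝ)⁻¹ *
      (Real.log ((n + 1) * L) + |β| * (τ * L))) atTop (𝓝 0) := by
    have hx : Tendsto (fun n : ℕ => ((n : ℝ) + 1) * L) atTop atTop :=
      (tendsto_atTop_add_const_right _ _ tendsto_natCast_atTop_atTop).atTop_mul_const hL0
    have hlog := Real.isLittleO_log_id_atTop.tendsto_div_nhds_zero.comp hx
    have hinv : Tendsto (fun n : ℕ => (n : ℝ)⁻¹) atTop (𝓝 0) := tendsto_inv_atTop_nhds_zero_nat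
    have h0 := (hlog.mul ((hinv.mul_const (L : ℝ)).const_add (L : ℝ))).add
      (hinv.mul_const (|β| * (τ * L)))
    rw [zero_mul, zero_mul, add_zero] at h0
    refine h0.congr' ?_
    filter_upwards [eventually_gt_atTop 0] with n hn
    have hn' : (0 : ℝ) < n := by exact_mod_cast hn
    simp only [Function.comp_apply, id]
    field_simp
  have hbound : ∀ᶠ n : ℕ in atTop, (n : ℝ)⁻¹ *
      mapEntropy μ (fun x (i : Fin n) => p (f^[i] x)) ≤ z := by
    filter_upwards [hlim.eventually_lt_const hκ, eventually_gt_atTop 0,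
      tendsto_natCast_atTop_atTop.eventually_ge_atTop (T₀ / τ)] with n hn hn0 hnT
    have hn0' : (0 : ℝ) < n := by exact_mod_cast hn0
    have hG : ∀ j : ℕ, ∃ G : Finset X, n ≤ j → IsSpanningSetOf f n ε (inducedXn f ψ (τ * j) n) G ∧
        ∑ x ∈ G, Real.exp (birkhoff f φ n x) ≤ Real.exp (β * (τ * j)) := by
      intro j
      by_cases hj : n ≤ j
      · have hTj : T₀ ≤ τ * j := by
          rw [div_le_iff₀' hτ] at hnT
          exact hnT.trans (mul_le_mul_of_nonneg_left (by exact_mod_cast hj) hτ.le)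
        obtain ⟨G, hG⟩ := hT₀ _ hTj n
        exact ⟨G, fun _ => hG⟩
      · exact ⟨∅, fun h => absurd h hj⟩
    choose G hG using hG
    have key := mapEntropy_itinerary_le hpres hψ hφ hτ hx₀ hψL (fun j hj => (hG j hj).1)
      (fun j hj => (hG j hj).2) hεφ hp hB hr hv1 hκ.le hvc hvκ
    have hmul := mul_le_mul_of_nonneg_left key (inv_pos.2 hn0').le
    rw [mul_add, inv_mul_cancel_left₀ hn0'.ne'] at hmul
    linarith
  refine liminf_le_of_frequently_le' (hbound.mono fun n hn => ?_).frequently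
  exact_mod_cast hn

/-- If `μ₀ ∈ M(X,f)` satisfies
`h_{μ₀}(f) = inf{P_ψ(φ)·∫ψ dμ₀ − ∫φ dμ₀ : φ ∈ C(X,ℝ)}`, then the entropy map
`μ ↦ h_μ(f)` is upper semi-continuous at `μ₀` on `M(X,f)` with the weak* topology. -/
theorem entropy_upperSemicontinuous_at
    {X : Type*} [MetricSpace X] [CompactSpace X] [Nonempty X]
    [MeasurableSpace X] [BorelSpace X]
    (f : X → X) (hf : Continuous f)
    (ψ : X → ℝ) (hψ : Continuous ψ) (hψpos : ∀ x, 0 < ψ x)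
    (htop : topEntropy f < ⊤)
    (μ₀ : ProbabilityMeasure X) (hinv₀ : (μ₀ : Measure X) ∈ invMeasures f)
    (hent : measEntropy f (μ₀ : Measure X) =
      ⨅ φ : C(X, ℝ),
        (inducedPressure f ψ φ * ((∫ x, ψ x ∂(μ₀ : Measure X) : ℝ) : EReal) -
          ((∫ x, φ x ∂(μ₀ : Measure X) : ℝ) : EReal))) :
    UpperSemicontinuousWithinAt
      (fun μ : ProbabilityMeasure X => measEntropy f (μ : Measure X))
      {μ : ProbabilityMeasure X | (μ : Measure X) ∈ invMeasures f} μ₀ := by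
  have hcont : ∀ g : X → ℝ, Continuous g →
      Tendsto (fun μ : ProbabilityMeasure X => ∫ x, g x ∂(μ : Measure X)) (𝓝 μ₀)
        (𝓝 (∫ x, g x ∂(μ₀ : Measure X))) := fun g hg =>
    ProbabilityMeasure.tendsto_iff_forall_integral_tendsto.1 tendsto_id
      (BoundedContinuousFunction.mkOfCompact ⟨g, hg⟩)
  intro c hc
  simp only at hc
  rw [hent] at hc
  obtain ⟨φ, hφ⟩ := iInf_lt_iff.1 hc
  have hψμ₀ : 0 < ∫ x, ψ x ∂(μ₀ : Measure X) :=
    (integral_pos_iff_support_of_nonneg (fun x => (hψpos x).le)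
      (hψ.integrable_of_hasCompactSupport (.of_compactSpace ψ))).2 (by
        rw [Function.support_eq_univ fun x => (hψpos x).ne']
        simp)
  obtain ⟨z, hz, hzc⟩ := EReal.lt_iff_exists_real_btwn.1 hφ
  have hP : inducedPressure f ψ φ < (((z + ∫ x, φ x ∂(μ₀ : Measure X)) /
      ∫ x, ψ x ∂(μ₀ : Measure X) : ℝ) : EReal) := by
    rw [EReal.coe_div, EReal.lt_div_iff (by exact_mod_cast hψμ₀) (EReal.coe_ne_top _),
      EReal.coe_add]
    exact (EReal.sub_lt_iff (Or.inl (EReal.coe_ne_bot _)) (Or.inl (EReal.coe_ne_top _))).1 hz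
  set β := (z + ∫ x, φ x ∂(μ₀ : Measure X)) / ∫ x, ψ x ∂(μ₀ : Measure X) with hβ
  have hlim := ((hcont ψ hψ).const_mul β).sub (hcont φ φ.continuous)
  have hz' : β * ∫ x, ψ x ∂(μ₀ : Measure X) - ∫ x, φ x ∂(μ₀ : Measure X) = z := by
    rw [hβ, div_mul_cancel₀ _ hψμ₀.ne', add_sub_cancel_right]
  rw [hz'] at hlim
  have hev := (continuous_coe_real_ereal.tendsto z).comp hlim |>.eventually_lt_const hzc
  filter_upwards [nhdsWithin_le_nhds hev, self_mem_nhdsWithin] with μ hμ hμinv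
  exact (measEntropy_le_of_inducedPressure_lt hf hψ hψpos φ.continuous hP hμinv).trans_lt hμ
end
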